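/- arXiv:1602.03231 — 3 statements merged into one kernel-verified Lean document; each statement's English description precedes it below -/
import Mathlib

section
/- The derivative of a proper Christoffel word is a Christoffel word: if w = a·ψ(v)·b for some v ∈ A*, then ∂w is a Christoffel word. -/
namespace Chri

/-- Length of the longest palindromic suffix of `w`. -/
def lpsLen (w : List Bool) : ℕ :=
  ((List.range (w.length + 1)).filter
    (fun l => w.drop (w.length - l) == (w.drop (w.length - l)).reverse)).foldr max 0

/-- Right palindromic closure: the shortest palindrome having `w` as a prefix. -/
def palClosure (w : List Bool) : List Bool :=
  w ++ (w.take (w.length - lpsLen w)).reverse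

/-- The iterated palindromization map ψ. -/
def psi (v : List Bool) : List Bool :=
  v.foldl (fun w x => palClosure (w ++ [x])) []

/-- Apply a substitution (morphism of the free monoid) letter by letter. -/
def applyM (f : Bool → List Bool) (w : List Bool) : List Bool := (w.map f).flatten

/-- μ_x : x ↦ x, y ↦ xy (a = false, b = true). -/
def muL (x : Bool) : List Bool → List Bool :=
  applyM (fun y => if y = x then [x] else [x, y])

/-- λ_a = μ_a; λ_b : a ↦ ab, b ↦ b. -/
def lamL : Bool → List Bool → List Bool
  | false => applyM (fun y => if y = false then [false] else [false, true])
  | true  => applyM (fun y => if y = true then [true] else [false, true])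

/-- μ_{v₁⋯v_n} = μ_{v₁} ∘ ⋯ ∘ μ_{v_n}. -/
def muW : List Bool → List Bool → List Bool
  | [], w => w
  | x :: v, w => muL x (muW v w)

/-- λ_{v₁⋯v_n} = λ_{v₁} ∘ ⋯ ∘ λ_{v_n}. -/
def lamW : List Bool → List Bool → List Bool
  | [], w => w
  | x :: v, w => lamL x (lamW v w)

/-- Christoffel words: the letters and the words aψ(v)b. -/
def IsChristoffel (w : List Bool) : Prop :=
  w = [false] ∨ w = [true] ∨ ∃ v, w = false :: (psi v ++ [true])

/-- A word is constant if it is a power of a single letter. -/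
def IsConstant (v : List Bool) : Prop := ∃ x n, v = List.replicate n x

/-- ₊v : the longest proper suffix of v immediately preceded by the complement of
the first letter of v. -/
def plusV (v : List Bool) : List Bool :=
  (v.dropWhile (fun y => y == v.headD false)).tail

/-- v₊ : the longest proper prefix of v immediately followed by the complement of
the last letter of v. -/
def vPlus (v : List Bool) : List Bool := (plusV v.reverse).reverse

/-- α₀: the length of the first maximal block of `v` (the index). -/
def blockLen (v : List Bool) : ℕ :=
  (v.takeWhile (fun y => y == v.headD false)).length

/-- The list of lengths of the maximal blocks of equal letters of `v`
(the integral representation (α₀, …, α_n)). -/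
def blockLens : List Bool → List ℕ
  | [] => []
  | [_] => [1]
  | x :: y :: v =>
    if x = y then
      match blockLens (y :: v) with
      | [] => [1]
      | n :: ns => (n + 1) :: ns
    else 1 :: blockLens (y :: v)

/-- ext(v) = number of maximal blocks of v. -/
def ext (v : List Bool) : ℕ := (blockLens v).length

/-- π(w): the minimal period of `w` (with π(ε) = 1). -/
noncomputable def minPeriod (w : List Bool) : ℕ :=
  sInf {p | 0 < p ∧ ∀ i, i + p < w.length → w.getD i false = w.getD (i + p) false}

/-- φ_k : a ↦ a^{k+1} b, b ↦ a^k b. -/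
def phi (k : ℕ) : List Bool → List Bool :=
  applyM (fun y => if y = false then List.replicate (k + 1) false ++ [true]
                   else List.replicate k false ++ [true])

/-- φ̂_k : a ↦ a b^k, b ↦ a b^{k+1}. -/
def phiHat (k : ℕ) : List Bool → List Bool :=
  applyM (fun y => if y = false then false :: List.replicate k true
                   else false :: List.replicate (k + 1) true)

attribute [local instance] Classical.propDecidable

/-- The derivative ∂w of a proper Christoffel word w = aψ(v)b of index k:
∂(ab) = a, and otherwise the preimage of w under φ_k (if v starts with a)
or φ̂_k (if v starts with b). -/
noncomputable def derivC (w : List Bool) : List Bool :=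
  if w = [false, true] then [false]
  else if h : ∃ v, v ≠ [] ∧ w = false :: (psi v ++ [true]) then
    if h.choose.headD false = false then Function.invFun (phi (blockLen h.choose)) w
    else Function.invFun (phiHat (blockLen h.choose)) w
  else w

/-- The depth of a Christoffel word: the least d with ∂^d w a single letter. -/
noncomputable def depth (w : List Bool) : ℕ :=
  sInf {d | derivC^[d] w = [false] ∨ derivC^[d] w = [true]}

/-- The height h(v): the least n ≥ 1 such that v_(n) is constant, where
v_(1) = v and v_(n+1) = ₊(v_(n)). -/
noncomputable def height (v : List Bool) : ℕ :=
  sInf {n | 0 < n ∧ IsConstant (plusV^[n - 1] v)}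

/-- Helper computing δ_i from (α_{i-1}, δ_{i-1}) along the remaining exponents. -/
def ruleAux : ℕ → ℕ → List ℕ → List ℕ
  | _, _, [] => []
  | pa, pd, a :: rest =>
    let d := if 1 < a then 1 else if 1 < pa then 0 else 1 - pd
    d :: ruleAux a d rest

/-- The sequence δ₀, δ₁, …, δ_n computed by the recursive rule (δ₀ = 1). -/
def ruleSeq : List ℕ → List ℕ
  | [] => []
  | a :: rest => 1 :: ruleAux a 1 rest

/-- δ(v) = Σ_{i=0}^n δ_i(v), where additionally δ_n(v) = 1; δ(ε) = 1. -/
def delta (v : List Bool) : ℕ := ((ruleSeq (blockLens v)).dropLast).sum + 1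

/-- |u₁|: length of the longest prefix x₀⋯x_i of u with i < n and α₀ = ⋯ = α_i = 1
(and 0 if α₀ > 1 or n = 0). -/
def u1len (u : List Bool) : ℕ :=
  min ((blockLens u).takeWhile (fun n => n == 1)).length ((blockLens u).length - 1)

/-- |u₂|: the symmetric notion for suffixes. -/
def u2len (u : List Bool) : ℕ := u1len u.reverse

/-- The sequence H: H(1) = 0, H(2n) = H(n), H(4n±1) = H(n)+1. -/
def H : ℕ → ℕ
  | 0 => 0
  | 1 => 0
  | n + 2 =>
    if (n + 2) % 2 = 0 then H ((n + 2) / 2)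
    else if (n + 2) % 4 = 1 then H ((n + 2) / 4) + 1
    else H ((n + 3) / 4) + 1
decreasing_by all_goals omega

/-- ⟨w⟩: the word w read as an integer in base 2 (a = 0, b = 1). -/
def wordVal (w : List Bool) : ℕ :=
  w.foldl (fun acc x => 2 * acc + (if x then 1 else 0)) 0

/-- Membership in X^*: w is a concatenation of words of X. -/
def InStar (X : Set (List Bool)) (w : List Bool) : Prop :=
  ∃ l : List (List Bool), (∀ u ∈ l, u ∈ X) ∧ w = l.flatten

/-- w ∈ x⁺. -/
def PowPos (x : Bool) (w : List Bool) : Prop := ∃ k, 0 < k ∧ w = List.replicate k x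

section Morphisms

@[simp]
theorem applyM_nil (f : Bool → List Bool) : applyM f [] = [] := rfl

@[simp]
theorem applyM_cons (f : Bool → List Bool) (c : Bool) (w : List Bool) :
    applyM f (c :: w) = f c ++ applyM f w := rfl

@[simp]
theorem applyM_append (f : Bool → List Bool) (u w : List Bool) :
    applyM f (u ++ w) = applyM f u ++ applyM f w := by
  simp [applyM]

theorem applyM_reverse (f : Bool → List Bool) (w : List Bool) :
    (applyM f w).reverse = applyM (fun c => (f c).reverse) w.reverse := by
  induction w with
  | nil => rfl
  | cons c w ih => simp [ih]

theorem applyM_comp {f g h : Bool → List Bool} (H : ∀ c, applyM f (g c) = h c) (w : List Bool) :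
    applyM f (applyM g w) = applyM h w := by
  induction w with
  | nil => rfl
  | cons c w ih => simp [ih, H]

/-- A substitution is injective if its two images branch, with the letter itself,
after a common prefix. -/
theorem applyM_injective {f : Bool → List Bool} {p : List Bool}
    (h : ∀ c, ∃ r, f c = p ++ c :: r) : Function.Injective (applyM f) := by
  intro u
  induction u with
  | nil =>
    intro w hw
    cases w with
    | nil => rfl
    | cons d w =>
      obtain ⟨r, hr⟩ := h d
      simp [hr] at hw
  | cons c u ih =>
    intro w hw
    cases w with
    | nil =>
      obtain ⟨r, hr⟩ := h c
      simp [hr] at hw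
    | cons d w =>
      have hcd : c = d := by
        obtain ⟨r, hr⟩ := h c
        obtain ⟨s, hs⟩ := h d
        simp only [applyM_cons, hr, hs, List.append_assoc, List.cons_append] at hw
        exact (List.cons.inj (List.append_cancel_left hw)).1
      subst hcd
      simp only [applyM_cons] at hw
      rw [ih (List.append_cancel_left hw)]

theorem applyM_injective_of_reverse {f : Bool → List Bool} {p : List Bool}
    (h : ∀ c, ∃ r, (f c).reverse = p ++ c :: r) : Function.Injective (applyM f) := by
  intro u w huw
  have := congrArg List.reverse huw
  rw [applyM_reverse, applyM_reverse] at this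
  exact List.reverse_injective (applyM_injective h this)

theorem phi_injective (k : ℕ) : Function.Injective (phi k) := by
  refine applyM_injective (p := List.replicate k false) fun c => ?_
  cases c
  · exact ⟨[true], by simp [List.replicate_succ']⟩
  · exact ⟨[], by simp⟩

theorem phiHat_injective (k : ℕ) : Function.Injective (phiHat k) := by
  refine applyM_injective_of_reverse (p := List.replicate k true) fun c => ?_
  cases c
  · exact ⟨[], by simp⟩
  · refine ⟨[false], ?_⟩
    rw [if_neg (by decide), List.reverse_cons, List.reverse_replicate, List.replicate_succ']
    simp

theorem muL_injective (x : Bool) : Function.Injective (muL x) := by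
  refine applyM_injective_of_reverse (p := []) fun c => ?_
  by_cases hc : c = x
  · exact ⟨[], by simp [hc]⟩
  · exact ⟨[x], by simp [hc]⟩

@[simp]
theorem muL_nil (x : Bool) : muL x [] = [] := rfl

@[simp]
theorem muL_append (x : Bool) (u w : List Bool) : muL x (u ++ w) = muL x u ++ muL x w :=
  applyM_append _ u w

theorem muL_cons_self (x : Bool) (w : List Bool) : muL x (x :: w) = x :: muL x w := by
  simp [muL]

theorem muL_cons_of_ne {x c : Bool} (hc : c ≠ x) (w : List Bool) :
    muL x (c :: w) = x :: c :: muL x w := by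
  simp [muL, hc]

theorem cons_muL_reverse (x : Bool) (w : List Bool) :
    x :: (muL x w).reverse = muL x w.reverse ++ [x] := by
  induction w with
  | nil => rfl
  | cons c w ih =>
    by_cases hc : c = x
    · subst hc
      rw [muL_cons_self, List.reverse_cons, ← List.cons_append, ih]
      simp [muL_cons_self]
    · rw [muL_cons_of_ne hc, List.reverse_cons, List.reverse_cons, ← List.cons_append,
        ← List.cons_append, ih]
      simp [muL_cons_of_ne hc]

theorem reverse_muL_append (x : Bool) (w : List Bool) :
    (muL x w ++ [x]).reverse = muL x w.reverse ++ [x] := by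
  rw [← cons_muL_reverse]; simp

theorem reverse_cons_append_singleton_iff (x : Bool) (t : List Bool) :
    (x :: t ++ [x]).reverse = x :: t ++ [x] ↔ t.reverse = t := by
  simp

theorem muL_append_reverse_eq_iff (x : Bool) (w : List Bool) :
    (muL x w ++ [x]).reverse = muL x w ++ [x] ↔ w.reverse = w := by
  rw [reverse_muL_append, List.append_left_inj, (muL_injective x).eq_iff]

/-- A suffix of `μ_x(u)x` beginning with `x` has the form `μ_x(r)x` with `r` a suffix of `u`. -/
theorem exists_suffix_of_muL_append {x : Bool} {u p t : List Bool}
    (h : muL x u ++ [x] = p ++ x :: t) : ∃ q r, u = q ++ r ∧ x :: t = muL x r ++ [x] := by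
  induction u generalizing p with
  | nil =>
    refine ⟨[], [], rfl, ?_⟩
    cases p <;> simp_all
  | cons c u ih =>
    rcases p with _ | ⟨d, p⟩
    · exact ⟨[], c :: u, rfl, h.symm⟩
    by_cases hc : c = x
    · subst hc
      rw [muL_cons_self] at h
      obtain ⟨q, r, rfl, hr⟩ := ih (List.cons.inj h).2
      exact ⟨c :: q, r, rfl, hr⟩
    · rw [muL_cons_of_ne hc] at h
      rcases p with _ | ⟨e, p⟩
      · exact absurd (List.cons.inj (List.cons.inj h).2).1 hc
      · obtain ⟨q, r, rfl, hr⟩ := ih (List.cons.inj (List.cons.inj h).2).2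
        exact ⟨c :: q, r, rfl, hr⟩

/-- In `μ_x(u)x`, every letter other than `x` is preceded by `x`. -/
theorem exists_eq_append_of_muL_append {x y : Bool} (hy : y ≠ x) {u p t : List Bool}
    (h : muL x u ++ [x] = p ++ y :: t) : ∃ p', p = p' ++ [x] := by
  induction u generalizing p with
  | nil => cases p <;> simp_all
  | cons c u ih =>
    by_cases hc : c = x
    · subst hc
      rw [muL_cons_self] at h
      rcases p with _ | ⟨d, p⟩
      · exact absurd (List.cons.inj h).1.symm hy
      obtain ⟨p', rfl⟩ := ih (List.cons.inj h).2
      exact ⟨d :: p', rfl⟩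
    · rw [muL_cons_of_ne hc] at h
      rcases p with _ | ⟨d, _ | ⟨e, p⟩⟩
      · exact absurd (List.cons.inj h).1.symm hy
      · exact ⟨[], by rw [(List.cons.inj h).1]; rfl⟩
      · obtain ⟨p', rfl⟩ := ih (List.cons.inj (List.cons.inj h).2).2
        exact ⟨d :: e :: p', rfl⟩

end Morphisms

section Closure

/-- `s` is the longest palindromic suffix of `p ++ s`. -/
def IsLongestPalSuffix (p s : List Bool) : Prop :=
  s.reverse = s ∧ ∀ q r, p ++ s = q ++ r → r.reverse = r → r.length ≤ s.length

theorem exists_isLongestPalSuffix (u : List Bool) :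
    ∃ p s, u = p ++ s ∧ IsLongestPalSuffix p s := by
  induction u with
  | nil => exact ⟨[], [], rfl, rfl, fun q r h _ => by simp_all⟩
  | cons c u ih =>
    by_cases hc : (c :: u).reverse = c :: u
    · refine ⟨[], c :: u, rfl, hc, fun q r h _ => ?_⟩
      have := congrArg List.length h
      simp only [List.length_append, List.nil_append] at this
      omega
    · obtain ⟨p, s, rfl, hs, hmax⟩ := ih
      refine ⟨c :: p, s, rfl, hs, fun q r h hr => ?_⟩
      rcases q with _ | ⟨d, q⟩
      · rw [List.nil_append] at h
        rw [← h] at hr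
        exact absurd hr hc
      · exact hmax q r (List.cons.inj h).2 hr

theorem foldr_max_le {l : List ℕ} {n : ℕ} (h : ∀ m ∈ l, m ≤ n) : l.foldr max 0 ≤ n := by
  induction l with
  | nil => exact Nat.zero_le n
  | cons a l ih => simp_all

theorem le_foldr_max {l : List ℕ} {n : ℕ} (h : n ∈ l) : n ≤ l.foldr max 0 := by
  induction l with
  | nil => simp at h
  | cons a l ih =>
    rcases List.mem_cons.1 h with rfl | h
    · simp
    · simp [ih h]

theorem IsLongestPalSuffix.lpsLen_eq {p s : List Bool} (h : IsLongestPalSuffix p s) :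
    lpsLen (p ++ s) = s.length := by
  apply le_antisymm
  · refine foldr_max_le fun m hm => ?_
    simp only [List.mem_filter, List.mem_range, beq_iff_eq] at hm
    have := h.2 _ _ (List.take_append_drop ((p ++ s).length - m) (p ++ s)).symm hm.2.symm
    rw [List.length_drop] at this
    omega
  · refine le_foldr_max ?_
    simp [h.1]

theorem IsLongestPalSuffix.palClosure_eq {p s : List Bool} (h : IsLongestPalSuffix p s) :
    palClosure (p ++ s) = p ++ s ++ p.reverse := by
  simp [palClosure, h.lpsLen_eq]

theorem length_muL_le_of_suffix {x : Bool} {p s q r : List Bool} (h : p ++ s = q ++ r)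
    (hrs : r.length ≤ s.length) : (muL x r).length ≤ (muL x s).length := by
  obtain ⟨t, rfl⟩ : r <:+ s :=
    List.suffix_of_suffix_length_le (h ▸ List.suffix_append q r) (List.suffix_append p s) hrs
  simp

/-- `μ_x(p s p~) x = μ_x(p) · μ_x(s) x · μ_x(p)~`. -/
theorem muL_closure (x : Bool) (p s : List Bool) :
    muL x (p ++ s ++ p.reverse) ++ [x] = muL x p ++ (muL x s ++ [x]) ++ (muL x p).reverse := by
  rw [muL_append, muL_append, List.append_assoc, ← cons_muL_reverse]
  simp

theorem IsLongestPalSuffix.muL_append_self {x : Bool} {p s : List Bool}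
    (h : IsLongestPalSuffix p s) : IsLongestPalSuffix (muL x p) (muL x s ++ [x]) := by
  refine ⟨(muL_append_reverse_eq_iff x s).2 h.1, fun q t ht htr => ?_⟩
  rcases t with _ | ⟨c, t⟩
  · simp
  have hc : c = x := by
    have h1 := congrArg List.reverse ht
    rw [List.reverse_append, List.reverse_append (as := q), htr] at h1
    simp at h1
    exact h1.1.symm
  subst hc
  rw [← List.append_assoc, ← muL_append] at ht
  obtain ⟨q', r, hu, hr⟩ := exists_suffix_of_muL_append ht
  rw [hr] at htr ⊢
  have := length_muL_le_of_suffix (x := c) hu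
    (h.2 q' r hu ((muL_append_reverse_eq_iff c r).1 htr))
  simpa using this

theorem palClosure_muL_append (x : Bool) (u : List Bool) :
    palClosure (muL x u ++ [x]) = muL x (palClosure u) ++ [x] := by
  obtain ⟨p, s, rfl, h⟩ := exists_isLongestPalSuffix u
  rw [h.palClosure_eq, muL_closure, muL_append, List.append_assoc,
    h.muL_append_self.palClosure_eq]

theorem palClosure_muL_of_ne {x y : Bool} (hy : y ≠ x) (u : List Bool) :
    palClosure (muL x (u ++ [y])) = muL x (palClosure (u ++ [y])) ++ [x] := by
  obtain ⟨p, s, hu, h⟩ := exists_isLongestPalSuffix (u ++ [y])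
  have hpos : 1 ≤ s.length := h.2 u [y] hu.symm rfl
  obtain ⟨s', rfl⟩ : ∃ s', s = y :: s' := by
    have h1 := congrArg List.reverse hu
    rw [List.reverse_append (as := p), h.1] at h1
    rcases s with _ | ⟨c, s⟩
    · simp at hpos
    · simp at h1
      exact ⟨s, by rw [h1.1]⟩
  have hpal := (muL_append_reverse_eq_iff x _).2 h.1
  rw [muL_cons_of_ne hy] at hpal
  have hlong : IsLongestPalSuffix (muL x p ++ [x]) (y :: muL x s') := by
    refine ⟨(reverse_cons_append_singleton_iff x _).1 hpal, fun q t ht htr => ?_⟩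
    rcases t with _ | ⟨c, t⟩
    · simp
    have hmu : muL x (u ++ [y]) = q ++ c :: t := by
      rw [← ht, hu, muL_append, muL_cons_of_ne hy]; simp
    have hc : c = y := by
      have h1 := congrArg List.reverse hmu
      rw [List.reverse_append (as := q), htr, muL_append, muL_cons_of_ne hy] at h1
      simp at h1
      exact h1.1.symm
    subst hc
    have hmu' : muL x (u ++ [c]) ++ [x] = q ++ c :: (t ++ [x]) := by rw [hmu]; simp
    obtain ⟨q', rfl⟩ := exists_eq_append_of_muL_append hy hmu'
    rw [List.append_assoc, List.singleton_append] at hmu'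
    obtain ⟨q'', r, hr, hMr⟩ := exists_suffix_of_muL_append hmu'
    have hrpal : r.reverse = r := by
      rw [← muL_append_reverse_eq_iff x, ← hMr]
      exact (reverse_cons_append_singleton_iff x _).2 htr
    have hlen := length_muL_le_of_suffix (x := x) (hu.symm.trans hr)
      (h.2 q'' r (hu.symm.trans hr) hrpal)
    have := congrArg List.length hMr
    rw [muL_cons_of_ne hy] at hlen
    simp at this hlen ⊢
    omega
  have hsplit : muL x (u ++ [y]) = (muL x p ++ [x]) ++ (y :: muL x s') := by
    rw [hu, muL_append, muL_cons_of_ne hy]; simp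
  rw [hsplit, hlong.palClosure_eq, hu, h.palClosure_eq, muL_closure, muL_cons_of_ne hy]
  simp

/-- Justin's formula for a single letter. -/
theorem psi_cons (x : Bool) (v : List Bool) : psi (x :: v) = muL x (psi v) ++ [x] := by
  have psi_concat (u : List Bool) (y : Bool) : psi (u ++ [y]) = palClosure (psi u ++ [y]) := by
    simp [psi]
  induction v using List.reverseRecOn with
  | nil => cases x <;> decide
  | append_singleton v y ih =>
    rw [← List.cons_append, psi_concat, psi_concat, ih]
    by_cases hy : y = x
    · subst hy
      rw [← palClosure_muL_append, muL_append, muL_cons_self, muL_nil]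
    · rw [← palClosure_muL_of_ne hy, muL_append, muL_cons_of_ne hy, muL_nil]
      simp

end Closure

theorem christoffel_false_cons (v : List Bool) :
    false :: (psi (false :: v) ++ [true]) = lamL false (false :: (psi v ++ [true])) := by
  have hmu (w : List Bool) : muL false w = lamL false w := by
    unfold muL lamL
    congr 1
    funext c
    cases c <;> rfl
  rw [psi_cons, hmu]
  simp [lamL]

theorem muL_true_append (w : List Bool) : muL true w ++ [true] = true :: lamL true w := by
  induction w with
  | nil => rfl
  | cons c w ih => cases c <;> simp_all [muL, lamL]

theorem christoffel_true_cons (v : List Bool) :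
    false :: (psi (true :: v) ++ [true]) = lamL true (false :: (psi v ++ [true])) := by
  rw [psi_cons, muL_true_append]
  simp [lamL]

theorem phi_zero (w : List Bool) : phi 0 w = lamL true w := by
  unfold phi lamL
  congr 1
  funext c
  cases c <;> rfl

theorem phiHat_zero (w : List Bool) : phiHat 0 w = lamL false w := by
  unfold phiHat lamL
  congr 1

theorem applyM_replicate {f : Bool → List Bool} {c : Bool} (h : f c = [c]) (k : ℕ) :
    applyM f (List.replicate k c) = List.replicate k c := by
  induction k with
  | zero => rfl
  | succ k ih => simp [List.replicate_succ, ih, h]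

theorem lamL_false_phi (k : ℕ) (w : List Bool) : lamL false (phi k w) = phi (k + 1) w := by
  refine applyM_comp (fun c => ?_) w
  cases c <;> simp [applyM_replicate, List.replicate_succ']

theorem lamL_true_phiHat (k : ℕ) (w : List Bool) :
    lamL true (phiHat k w) = phiHat (k + 1) w := by
  refine applyM_comp (fun c => ?_) w
  cases c <;> simp [applyM_replicate, List.replicate_succ]

theorem exists_phi_eq (v : List Bool) :
    ∃ u, IsChristoffel u ∧
      phi (v.takeWhile (fun y => y == false)).length u = false :: (psi v ++ [true]) := by
  induction v with
  | nil => exact ⟨[false], Or.inl rfl, rfl⟩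
  | cons c v ih =>
    cases c
    · obtain ⟨u, hu, h⟩ := ih
      refine ⟨u, hu, ?_⟩
      rw [christoffel_false_cons, ← h, lamL_false_phi]
      simp
    · exact ⟨_, Or.inr (Or.inr ⟨v, rfl⟩), by rw [christoffel_true_cons, ← phi_zero]; simp⟩

theorem exists_phiHat_eq (v : List Bool) :
    ∃ u, IsChristoffel u ∧
      phiHat (v.takeWhile (fun y => y == true)).length u = false :: (psi v ++ [true]) := by
  induction v with
  | nil => exact ⟨[true], Or.inr (Or.inl rfl), rfl⟩
  | cons c v ih =>
    cases c
    · exact ⟨_, Or.inr (Or.inr ⟨v, rfl⟩), by rw [christoffel_false_cons, ← phiHat_zero]; simp⟩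
    · obtain ⟨u, hu, h⟩ := ih
      refine ⟨u, hu, ?_⟩
      rw [christoffel_true_cons, ← h, lamL_true_phiHat]
      simp

/-- the derivative of a proper Christoffel word is a Christoffel word. -/
theorem deriv_isChristoffel (v w : List Bool) (hw : w = false :: (psi v ++ [true])) :
    IsChristoffel (derivC w) := by
  unfold derivC
  split_ifs with hab h hhead
  · exact Or.inl rfl
  · have hspec := h.choose_spec.2
    generalize h.choose = v' at hspec hhead ⊢
    obtain ⟨u, hu, hphi⟩ := exists_phi_eq v'
    rw [hspec, ← hphi, blockLen, hhead, Function.leftInverse_invFun (phi_injective _)]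
    exact hu
  · have hspec := h.choose_spec.2
    generalize h.choose = v' at hspec hhead ⊢
    obtain ⟨u, hu, hphi⟩ := exists_phiHat_eq v'
    rw [hspec, ← hphi, blockLen, Bool.eq_true_of_not_eq_false hhead,
      Function.leftInverse_invFun (phiHat_injective _)]
    exact hu
  · exact Or.inr (Or.inr ⟨v, hw⟩)

end Chri
end

section
/- For every word v over A = {a,b}, the height h(v) equals δ(v). -/
namespace Chri

attribute [local instance] Classical.propDecidable

theorem isConstant_or_exists_eq (v : List Bool) :
    IsConstant v ∨ ∃ x k w, v = List.replicate (k + 1) x ++ (!x) :: w := by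
  induction v with
  | nil => exact Or.inl ⟨false, 0, rfl⟩
  | cons y v ih =>
    rcases ih with ⟨x, n, rfl⟩ | ⟨x, k, w, rfl⟩
    · by_cases h : y = x
      · subst h
        exact Or.inl ⟨y, n + 1, rfl⟩
      · cases n with
        | zero => exact Or.inl ⟨y, 1, rfl⟩
        | succ n =>
          refine Or.inr ⟨y, 0, List.replicate n x, ?_⟩
          cases x <;> cases y <;> simp_all [List.replicate_succ]
    · right
      by_cases h : y = x
      · subst h
        exact ⟨y, k + 1, w, rfl⟩
      · refine ⟨y, 0, List.replicate k x ++ (!x) :: w, ?_⟩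
        cases x <;> cases y <;> simp_all [List.replicate_succ]

theorem not_isConstant_replicate_append (x : Bool) (k : ℕ) (w : List Bool) :
    ¬ IsConstant (List.replicate (k + 1) x ++ (!x) :: w) := by
  rintro ⟨y, n, h⟩
  have hx : x ∈ List.replicate n y := by rw [← h]; simp
  have hx' : (!x) ∈ List.replicate n y := by rw [← h]; simp
  have e := List.eq_of_mem_replicate hx
  have e' := List.eq_of_mem_replicate hx'
  cases x <;> simp_all

theorem plusV_replicate_append (x : Bool) (k : ℕ) (w : List Bool) :
    plusV (List.replicate (k + 1) x ++ (!x) :: w) = w := by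
  have hd : (List.replicate (k + 1) x ++ (!x) :: w).headD false = x := by
    simp [List.replicate_succ]
  rw [plusV, hd, List.dropWhile_append_of_pos (by simp)]
  cases x <;> simp

theorem blockLens_cons_ne_nil (x : Bool) (v : List Bool) : blockLens (x :: v) ≠ [] := by
  cases v with
  | nil => simp [blockLens]
  | cons y v =>
    rw [blockLens]
    split_ifs
    · split <;> simp
    · simp

theorem zero_notMem_blockLens (v : List Bool) : 0 ∉ blockLens v := by
  induction v with
  | nil => simp [blockLens]
  | cons x v ih =>
    cases v with
    | nil => simp [blockLens]
    | cons y v =>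
      rw [blockLens]
      split_ifs
      · split <;> simp_all
      · simpa using ih

theorem blockLens_cons_cons_self (x : Bool) (v : List Bool) {n : ℕ} {ns : List ℕ}
    (h : blockLens (x :: v) = n :: ns) : blockLens (x :: x :: v) = (n + 1) :: ns := by
  rw [blockLens, if_pos rfl, h]

theorem blockLens_cons_cons_of_ne {x y : Bool} (hxy : x ≠ y) (v : List Bool) :
    blockLens (x :: y :: v) = 1 :: blockLens (y :: v) := by
  rw [blockLens, if_neg hxy]

theorem blockLens_replicate (x : Bool) (k : ℕ) :
    blockLens (List.replicate (k + 1) x) = [k + 1] := by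
  induction k with
  | zero => simp [blockLens]
  | succ k ih => exact blockLens_cons_cons_self x _ ih

theorem blockLens_replicate_append (x : Bool) (k : ℕ) (w : List Bool) :
    blockLens (List.replicate (k + 1) x ++ (!x) :: w) = (k + 1) :: blockLens ((!x) :: w) := by
  induction k with
  | zero => exact blockLens_cons_cons_of_ne (by cases x <;> simp) w
  | succ k ih => exact blockLens_cons_cons_self x _ ih

theorem ruleAux_one_eq (p q : ℕ) (l : List ℕ) : ruleAux p 1 l = ruleAux q 1 l := by
  cases l <;> simp [ruleAux]

theorem delta_of_isConstant {v : List Bool} (h : IsConstant v) : delta v = 1 := by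
  obtain ⟨x, n, rfl⟩ := h
  cases n with
  | zero => rfl
  | succ n => simp [delta, blockLens_replicate, ruleSeq, ruleAux]

theorem delta_replicate_append (x : Bool) (k : ℕ) (w : List Bool) :
    delta (List.replicate (k + 1) x ++ (!x) :: w) = delta w + 1 := by
  unfold delta
  rw [blockLens_replicate_append]
  cases w with
  | nil => simp [blockLens, ruleSeq, ruleAux]
  | cons y w =>
    obtain ⟨n, ns, hn⟩ := List.exists_cons_of_ne_nil (blockLens_cons_ne_nil y w)
    have hpos : 0 < n := by
      have := zero_notMem_blockLens (y :: w)
      rw [hn] at this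
      simp at this
      omega
    by_cases h : (!x) = y
    · subst h
      rw [blockLens_cons_cons_self _ _ hn, hn]
      simp only [ruleSeq, ruleAux, if_pos (show 1 < n + 1 by omega), ruleAux_one_eq (n + 1) n]
      rw [List.dropLast_cons_of_ne_nil (by simp), List.sum_cons]
      omega
    · rw [blockLens_cons_cons_of_ne h, hn]
      simp [ruleSeq, ruleAux]
      omega

theorem height_of_isConstant {v : List Bool} (h : IsConstant v) : height v = 1 := by
  have hmem : 1 ∈ {n | 0 < n ∧ IsConstant (plusV^[n - 1] v)} := ⟨one_pos, h⟩
  exact le_antisymm (Nat.sInf_le hmem) (Nat.sInf_mem ⟨1, hmem⟩).1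

theorem exists_isConstant_iterate_plusV (v : List Bool) :
    ∃ n, IsConstant (plusV^[n] v) := by
  induction hl : v.length using Nat.strong_induction_on generalizing v with
  | _ l ih =>
    rcases isConstant_or_exists_eq v with h | ⟨x, k, w, rfl⟩
    · exact ⟨0, h⟩
    · obtain ⟨n, hn⟩ := ih w.length (by simp at hl; omega) w rfl
      exact ⟨n + 1, by rwa [Function.iterate_succ_apply, plusV_replicate_append]⟩

theorem height_of_not_isConstant {v : List Bool} (h : ¬ IsConstant v) :
    height v = height (plusV v) + 1 := by
  have mem_height (u : List Bool) :
      height u ∈ {n | 0 < n ∧ IsConstant (plusV^[n - 1] u)} := by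
    obtain ⟨n, hn⟩ := exists_isConstant_iterate_plusV u
    exact Nat.sInf_mem ⟨n + 1, Nat.succ_pos n, hn⟩
  apply le_antisymm
  · obtain ⟨hpos, hc⟩ := mem_height (plusV v)
    refine Nat.sInf_le ⟨Nat.succ_pos _, ?_⟩
    rwa [← Function.iterate_succ_apply, Nat.succ_eq_add_one, Nat.sub_add_cancel hpos] at hc
  · obtain ⟨hpos, hc⟩ := mem_height v
    obtain ⟨m, hm⟩ := Nat.exists_eq_add_of_lt hpos
    rw [hm] at hc ⊢
    cases m with
    | zero => exact absurd hc h
    | succ m =>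
      have : height (plusV v) ≤ m + 1 := by
        refine Nat.sInf_le ⟨Nat.succ_pos _, ?_⟩
        simpa using hc
      omega

/-- h(v) = δ(v) for every word v. -/
theorem height_eq_delta (v : List Bool) : height v = delta v := by
  induction hl : v.length using Nat.strong_induction_on generalizing v with
  | _ l ih =>
    rcases isConstant_or_exists_eq v with h | ⟨x, k, w, rfl⟩
    · rw [height_of_isConstant h, delta_of_isConstant h]
    · rw [height_of_not_isConstant (not_isConstant_replicate_append x k w),
        plusV_replicate_append, delta_replicate_append,
        ih w.length (by simp at hl; omega) w rfl]

end Chri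
end

section
/- For every word v over A = {a,b}, h(v) = H(⟨b v b⟩), where ⟨b v b⟩ is the integer obtained by reading the word b v b in base 2 with a = 0 and b = 1. -/
namespace Chri

attribute [local instance] Classical.propDecidable

/-- One plus the number of disjoint factors `ab`, `ba` found by reading a word from left to
right. -/
def greedyHeight : List Bool → ℕ
  | [] => 1
  | [_] => 1
  | x :: y :: w => if x = y then greedyHeight (y :: w) else greedyHeight w + 1

theorem plusV_cons_cons_self (x : Bool) (w : List Bool) :
    plusV (x :: x :: w) = plusV (x :: w) := by
  simp [plusV]

theorem plusV_cons_cons_of_ne {x y : Bool} (h : x ≠ y) (w : List Bool) :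
    plusV (x :: y :: w) = w := by
  simp [plusV, h.symm]

theorem isConstant_nil : IsConstant [] := ⟨true, 0, rfl⟩

theorem isConstant_singleton (x : Bool) : IsConstant [x] := ⟨x, 1, rfl⟩

theorem isConstant_cons_cons_iff {x y : Bool} {w : List Bool} :
    IsConstant (x :: y :: w) ↔ x = y ∧ IsConstant (y :: w) := by
  constructor
  · rintro ⟨z, n, h⟩
    rcases n with _ | _ | n
    · simp at h
    · simp at h
    · simp only [List.replicate_succ, List.cons.injEq] at h
      obtain ⟨rfl, rfl, rfl⟩ := h
      exact ⟨rfl, _, n + 1, rfl⟩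
  · rintro ⟨rfl, z, n, h⟩
    rcases n with _ | n
    · simp at h
    · simp only [List.replicate_succ, List.cons.injEq] at h
      obtain ⟨rfl, rfl⟩ := h
      exact ⟨x, n + 2, rfl⟩

theorem isLeast_greedyHeight (v : List Bool) :
    IsLeast {n | 0 < n ∧ IsConstant (plusV^[n - 1] v)} (greedyHeight v) := by
  induction v using greedyHeight.induct with
  | case1 => exact ⟨⟨one_pos, isConstant_nil⟩, fun n hn => hn.1⟩
  | case2 x => exact ⟨⟨one_pos, isConstant_singleton x⟩, fun n hn => hn.1⟩
  | case3 x w ih =>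
    have hset : {n | 0 < n ∧ IsConstant (plusV^[n - 1] (x :: x :: w))} =
        {n | 0 < n ∧ IsConstant (plusV^[n - 1] (x :: w))} := by
      ext n
      rcases n with _ | _ | n
      · simp
      · simp [isConstant_cons_cons_iff]
      · simp [plusV_cons_cons_self]
    rw [hset]
    simpa [greedyHeight] using ih
  | case4 x y w hxy ih =>
    rw [greedyHeight, if_neg hxy]
    obtain ⟨⟨hpos, hconst⟩, hle⟩ := ih
    constructor
    · refine ⟨Nat.succ_pos _, ?_⟩
      obtain ⟨m, hm⟩ := Nat.exists_eq_succ_of_ne_zero hpos.ne'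
      rw [hm] at hconst ⊢
      simpa [plusV_cons_cons_of_ne hxy] using hconst
    · rintro n ⟨hn, hc⟩
      rcases n with _ | _ | n
      · simp at hn
      · exact absurd (isConstant_cons_cons_iff.1 hc).1 hxy
      · refine Nat.succ_le_succ (hle ⟨Nat.succ_pos n, ?_⟩)
        simpa [plusV_cons_cons_of_ne hxy] using hc

theorem height_eq_greedyHeight (v : List Bool) : height v = greedyHeight v :=
  (isLeast_greedyHeight v).csInf_eq

theorem greedyHeight_replicate (x : Bool) (k : ℕ) :
    greedyHeight (List.replicate k x) = 1 := by
  induction k with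
  | zero => rfl
  | succ k ih =>
    rcases k with _ | k
    · rfl
    · rw [List.replicate_succ] at ih
      simpa [List.replicate_succ, greedyHeight] using ih

/-- Removing the last block of a word together with the letter before it lowers the greedy
height by one. -/
theorem greedyHeight_append_block (u : List Bool) (y : Bool) (k : ℕ) :
    greedyHeight (u ++ y :: List.replicate (k + 1) (!y)) = greedyHeight u + 1 := by
  induction u using greedyHeight.induct with
  | case1 => simp [greedyHeight, List.replicate_succ, greedyHeight_replicate]
  | case2 x =>
    by_cases h : x = y
    · simp [greedyHeight, List.replicate_succ, greedyHeight_replicate, h]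
    · simp [greedyHeight, greedyHeight_replicate, h]
  | case3 x w ih => simpa [greedyHeight] using ih
  | case4 x y' w h ih => simpa [greedyHeight, h] using ih

theorem eq_replicate_or_eq_append_block (v : List Bool) :
    (∃ x k, v = List.replicate k x) ∨
      ∃ u y k, v = u ++ y :: List.replicate (k + 1) (!y) := by
  induction v with
  | nil => exact .inl ⟨true, 0, rfl⟩
  | cons z v ih =>
    rcases ih with ⟨x, k, rfl⟩ | ⟨u, y, k, rfl⟩
    · rcases k with _ | k
      · exact .inl ⟨z, 1, rfl⟩
      · by_cases h : z = x
        · exact .inl ⟨x, k + 2, by rw [h]; rfl⟩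
        · refine .inr ⟨[], z, k, ?_⟩
          rw [Bool.eq_not_of_ne (Ne.symm h)]
          rfl
    · exact .inr ⟨z :: u, y, k, rfl⟩

theorem H_two_mul {n : ℕ} (hn : 0 < n) : H (2 * n) = H n := by
  obtain ⟨m, rfl⟩ := Nat.exists_eq_succ_of_ne_zero hn.ne'
  rw [show 2 * m.succ = 2 * m + 2 by omega, H, if_pos (by omega)]
  congr 1
  omega

theorem H_two_pow_mul (k : ℕ) {n : ℕ} (hn : 0 < n) : H (2 ^ k * n) = H n := by
  induction k with
  | zero => simp
  | succ k ih => rw [pow_succ', mul_assoc, H_two_mul (by positivity), ih]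

theorem H_of_eq_four_mul_add_one {N n : ℕ} (hn : 0 < n) (h : N = 4 * n + 1) :
    H N = H n + 1 := by
  obtain ⟨m, rfl⟩ : ∃ m, N = m + 2 := ⟨N - 2, by omega⟩
  rw [H, if_neg (by omega), if_pos (by omega)]
  congr 2
  omega

theorem H_of_add_one_eq_four_mul {N n : ℕ} (h : N + 1 = 4 * n) :
    H N = H n + 1 := by
  obtain ⟨m, rfl⟩ : ∃ m, N = m + 2 := ⟨N - 2, by omega⟩
  rw [H, if_neg (by omega), if_neg (by omega)]
  congr 2
  omega

theorem wordVal_append_singleton (w : List Bool) (x : Bool) :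
    wordVal (w ++ [x]) = 2 * wordVal w + (if x then 1 else 0) := by
  simp [wordVal]

theorem wordVal_append_replicate_false (w : List Bool) (k : ℕ) :
    wordVal (w ++ List.replicate k false) = 2 ^ k * wordVal w := by
  induction k with
  | zero => simp
  | succ k ih =>
    rw [List.replicate_succ', ← List.append_assoc, wordVal_append_singleton, ih, pow_succ]
    simp
    ring

theorem wordVal_append_replicate_true (w : List Bool) (k : ℕ) :
    wordVal (w ++ List.replicate k true) + 1 = 2 ^ k * (wordVal w + 1) := by
  induction k with
  | zero => simp
  | succ k ih =>
    rw [List.replicate_succ', ← List.append_assoc, wordVal_append_singleton, pow_succ,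
      mul_right_comm, ← ih]
    simp
    ring

theorem H_wordVal_replicate (x : Bool) (k : ℕ) :
    H (wordVal (true :: (List.replicate k x ++ [true]))) = 1 := by
  have hsingle : wordVal [true] = 1 := rfl
  have hsnoc := wordVal_append_singleton ([true] ++ List.replicate k x) true
  simp only [List.cons_append, List.nil_append, if_true] at hsnoc
  rw [hsnoc]
  cases x
  · rcases k with _ | k
    · rw [H_of_add_one_eq_four_mul (n := 1) (by simp [hsingle]), H]
    · have h := wordVal_append_replicate_false [true] (k + 1)
      rw [hsingle] at h
      simp only [List.cons_append, List.nil_append] at h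
      rw [H_of_eq_four_mul_add_one (n := 2 ^ k * 1) (by positivity) (by rw [h]; ring),
        H_two_pow_mul k one_pos, H]
  · have h := wordVal_append_replicate_true [true] k
    rw [hsingle] at h
    simp only [List.cons_append, List.nil_append] at h
    rw [H_of_add_one_eq_four_mul (n := 2 ^ k * 1) (by linarith),
      H_two_pow_mul k one_pos, H]

theorem H_wordVal_append_block (u : List Bool) (y : Bool) (k : ℕ) :
    H (wordVal (true :: ((u ++ y :: List.replicate (k + 1) (!y)) ++ [true]))) =
      H (wordVal (true :: (u ++ [true]))) + 1 := by
  have hsplit : true :: ((u ++ y :: List.replicate (k + 1) (!y)) ++ [true]) =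
      (((true :: u) ++ [y]) ++ List.replicate (k + 1) (!y)) ++ [true] := by simp
  have hu := wordVal_append_singleton (true :: u) true
  have huy := wordVal_append_singleton (true :: u) y
  rw [hsplit, wordVal_append_singleton, ← List.cons_append, hu]
  simp only [if_true]
  rw [← H_two_pow_mul k (Nat.succ_pos (2 * wordVal (true :: u)))]
  cases y
  · have h := wordVal_append_replicate_true ((true :: u) ++ [false]) (k + 1)
    rw [huy] at h
    apply H_of_add_one_eq_four_mul
    simp only [Bool.not_false, pow_succ, Bool.false_eq_true, if_false, add_zero, Nat.succ_eq_add_one] at h ⊢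
    linarith
  · have h := wordVal_append_replicate_false ((true :: u) ++ [true]) (k + 1)
    rw [huy] at h
    apply H_of_eq_four_mul_add_one (by positivity)
    simp only [Bool.not_true, pow_succ, if_true, Nat.succ_eq_add_one] at h ⊢
    linarith

theorem greedyHeight_eq_H (v : List Bool) :
    greedyHeight v = H (wordVal (true :: (v ++ [true]))) := by
  rcases eq_replicate_or_eq_append_block v with ⟨x, k, rfl⟩ | ⟨u, y, k, rfl⟩
  · rw [greedyHeight_replicate, H_wordVal_replicate]
  · rw [greedyHeight_append_block, H_wordVal_append_block, greedyHeight_eq_H u]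
termination_by v.length
decreasing_by simp_all

/-- h(v) = H(⟨b v b⟩). -/
theorem height_eq_H (v : List Bool) :
    height v = H (wordVal (true :: (v ++ [true]))) := by
  rw [height_eq_greedyHeight, greedyHeight_eq_H]

end Chri
end
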